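/- For each 0 ≤ i ≤ s let σ_{j_i} be an integer with σ_{j_i}·λ_{j_i} ≡ 1 (mod m). Call the set of arithmetic pure gaps at (j_0, …, j_s) whose entries all lie in {1, …, m−1} the bottom set. For a tuple a = (a_0, …, a_s) in the bottom set, define k_a = −1 − max_{0 ≤ v ≤ s} { ∑_{i=0}^{s} ⌊(a_i − a_v·σ_{j_v}·λ_{j_i})/m⌋ + ∑_{i=s+1}^{r} ⌊(−a_v·σ_{j_v}·λ_{j_i})/m⌋ }. Then the set of all arithmetic pure gaps at (j_0, …, j_s) equals { (m·k_0 + a_0, m·k_1 + a_1, …, m·k_s + a_s) : (a_0, …, a_s) is in the bottom set, k_0, …, k_s are nonnegative integers, and ∑_{i=0}^{s} k_i ≤ k_a }. -/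

import Mathlib

open Finset

/-- Floor of the rational number `x / m`. -/
noncomputable def fdivq (m : ℕ) (x : ℤ) : ℤ := ⌊(x : ℚ) / (m : ℚ)⌋

/-- The quantity `∑_{i=0}^{n-1} ⌊(a_i + t·λ_{c i})/m⌋ + ∑_{w ∉ range c} ⌊t·λ_w/m⌋`. -/
noncomputable def gapSum (m r n : ℕ) (lam : Fin (r + 1) → ℤ)
    (c : Fin n → Fin (r + 1)) (a : Fin n → ℤ) (t : ℤ) : ℤ :=
  (∑ i : Fin n, fdivq m (a i + t * lam (c i))) +
    ∑ w ∈ Finset.univ \ Finset.image c Finset.univ, fdivq m (t * lam w)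

/-- `(a 0, …, a (n-1))` is an *arithmetic pure gap* at the (pairwise distinct) indices
`c 0, …, c (n-1)` of `{0,…,r}`: the entries are nonnegative and for every
`t ∈ {0,…,m-1}` exactly one of the two Bartoli–Quoos–Zini conditions holds. -/
noncomputable def IsArithPureGap (m r n : ℕ) (lam : Fin (r + 1) → ℤ)
    (c : Fin n → Fin (r + 1)) (a : Fin n → ℤ) : Prop :=
  (∀ i, 0 ≤ a i) ∧
    ∀ t : ℤ, 0 ≤ t → t ≤ (m : ℤ) - 1 →
      Xor' (gapSum m r n lam c a t < 0)
        (0 ≤ gapSum m r n lam c a t ∧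
          ∀ i : Fin n, fdivq m (a i + t * lam (c i)) = fdivq m (a i + t * lam (c i) - 1))

theorem fdivq_eq_ediv (m : ℕ) (x : ℤ) : fdivq m x = x / m :=
  Rat.floor_intCast_div_natCast x m

theorem fdivq_add_mul {m : ℕ} (hm : 0 < m) (x q : ℤ) : fdivq m (x + m * q) = fdivq m x + q := by
  simp only [fdivq_eq_ediv]
  exact Int.add_mul_ediv_left x q (by omega)

theorem fdivq_eq_fdivq_sub_one_iff {m : ℕ} (hm : 0 < m) (x : ℤ) :
    fdivq m x = fdivq m (x - 1) ↔ ¬ (m : ℤ) ∣ x := by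
  have hm' : (0 : ℤ) < m := by exact_mod_cast hm
  simp only [fdivq_eq_ediv]
  constructor
  · rintro h ⟨y, rfl⟩
    rw [Int.mul_ediv_cancel_left _ hm'.ne'] at h
    have := Int.mul_ediv_self_le (x := (m : ℤ) * y - 1) hm'.ne'
    rw [← h] at this
    omega
  · intro h
    have h0 : x % m ≠ 0 := fun h' => h (Int.dvd_of_emod_eq_zero h')
    have h1 := Int.emod_nonneg x hm'.ne'
    have h2 := Int.emod_lt_of_pos x hm'
    have h3 : x - 1 = (x % m - 1) + m * (x / m) := by
      have := Int.emod_add_mul_ediv x m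
      omega
    rw [h3, Int.add_mul_ediv_left _ _ hm'.ne', Int.ediv_eq_zero_of_lt (a := x % m - 1) (by omega) (by omega),
      zero_add]

section gapSum

variable {m r n : ℕ} {lam : Fin (r + 1) → ℤ} {c : Fin n → Fin (r + 1)}

/-- `gapSum` is periodic in `t` with period `m`. -/
theorem gapSum_add_mul (hm : 0 < m) (hsum : ∑ i, lam i = 0) (hc : Function.Injective c)
    (a : Fin n → ℤ) (t q : ℤ) :
    gapSum m r n lam c a (t + m * q) = gapSum m r n lam c a t := by
  have h1 : ∀ i, fdivq m (a i + (t + m * q) * lam (c i)) =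
      fdivq m (a i + t * lam (c i)) + q * lam (c i) := fun i => by
    rw [← fdivq_add_mul hm]; ring_nf
  have h2 : ∀ w, fdivq m ((t + m * q) * lam w) = fdivq m (t * lam w) + q * lam w := fun w => by
    rw [← fdivq_add_mul hm]; ring_nf
  have h3 : ∑ i, lam (c i) + ∑ w ∈ univ \ image c univ, lam w = 0 := by
    rw [← hsum, ← sum_sdiff (subset_univ (image c univ)), sum_image hc.injOn, add_comm]
  simp only [gapSum, h1, h2, sum_add_distrib, ← mul_sum]
  linear_combination q * h3

theorem gapSum_mul_add (hm : 0 < m) (a k : Fin n → ℤ) (t : ℤ) :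
    gapSum m r n lam c (fun i => m * k i + a i) t = gapSum m r n lam c a t + ∑ i, k i := by
  have h1 : ∀ i, fdivq m (m * k i + a i + t * lam (c i)) =
      fdivq m (a i + t * lam (c i)) + k i := fun i => by
    rw [← fdivq_add_mul hm]; ring_nf
  simp only [gapSum, h1, sum_add_distrib]
  ring

theorem gapSum_congr_modEq (hm : 0 < m) (hsum : ∑ i, lam i = 0) (hc : Function.Injective c)
    (a : Fin n → ℤ) {t u : ℤ} (h : t ≡ u [ZMOD m]) :
    gapSum m r n lam c a t = gapSum m r n lam c a u := by
  obtain ⟨q, hq⟩ := h.dvd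
  rw [show u = t + m * q by linarith, gapSum_add_mul hm hsum hc]

theorem isArithPureGap_iff_forall_dvd (hm : 0 < m) (a : Fin n → ℤ) :
    IsArithPureGap m r n lam c a ↔ (∀ i, 0 ≤ a i) ∧ ∀ t : ℤ, 0 ≤ t → t ≤ (m : ℤ) - 1 →
      ∀ v, (m : ℤ) ∣ a v + t * lam (c v) → gapSum m r n lam c a t < 0 := by
  simp only [IsArithPureGap, fdivq_eq_fdivq_sub_one_iff hm]
  refine and_congr_right fun _ => forall_congr' fun t => forall_congr' fun _ =>
    forall_congr' fun _ => ?_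
  rcases lt_or_ge (gapSum m r n lam c a t) 0 with h | h
  · simp [Xor', h]
  · simp [Xor', h, h.not_gt]

/-- A tuple is a pure gap iff `gapSum` is negative at each `t` with `m ∣ a v + t * lam (c v)`,
that is, at `t = -(a v * σ v)`. -/
theorem isArithPureGap_iff (hm : 0 < m) (hsum : ∑ i, lam i = 0) (hc : Function.Injective c)
    {σ : Fin n → ℤ} (hσ : ∀ i, σ i * lam (c i) ≡ 1 [ZMOD m]) (a : Fin n → ℤ) :
    IsArithPureGap m r n lam c a ↔
      (∀ i, 0 ≤ a i) ∧ ∀ v, gapSum m r n lam c a (-(a v * σ v)) < 0 := by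
  have hm' : (0 : ℤ) < m := by exact_mod_cast hm
  rw [isArithPureGap_iff_forall_dvd hm]
  refine and_congr_right fun _ => ⟨fun h v => ?_, fun h t _ _ v hv => ?_⟩
  · have hmod := Int.mod_modEq (-(a v * σ v)) m
    rw [← gapSum_congr_modEq hm hsum hc a hmod]
    refine h _ (Int.emod_nonneg _ hm'.ne')
      (Int.le_sub_one_of_lt (Int.emod_lt_of_pos _ hm')) v (Int.modEq_zero_iff_dvd.1 ?_)
    calc a v + -(a v * σ v) % m * lam (c v)
        ≡ a v + -(a v * σ v) * lam (c v) [ZMOD m] := (hmod.mul_right _).add_left _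
      _ = a v - a v * (σ v * lam (c v)) := by ring
      _ ≡ a v - a v * 1 [ZMOD m] := ((hσ v).mul_left _).sub_left _
      _ = 0 := by ring
  · have hmod : t ≡ -(a v * σ v) [ZMOD m] := by
      calc t = t * 1 := by ring
        _ ≡ t * (σ v * lam (c v)) [ZMOD m] := ((hσ v).symm).mul_left _
        _ = (a v + t * lam (c v)) * σ v - a v * σ v := by ring
        _ ≡ 0 * σ v - a v * σ v [ZMOD m] :=
          ((Int.modEq_zero_iff_dvd.2 hv).mul_right _).sub_right _
        _ = -(a v * σ v) := by ring
    rw [gapSum_congr_modEq hm hsum hc a hmod]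
    exact h v

theorem isArithPureGap_mul_add_iff (hm : 0 < m) (hsum : ∑ i, lam i = 0)
    (hc : Function.Injective c) {σ : Fin n → ℤ} (hσ : ∀ i, σ i * lam (c i) ≡ 1 [ZMOD m])
    (a k : Fin n → ℤ) :
    IsArithPureGap m r n lam c (fun i => m * k i + a i) ↔
      (∀ i, 0 ≤ m * k i + a i) ∧
        ∀ v, gapSum m r n lam c a (-(a v * σ v)) + ∑ i, k i < 0 := by
  rw [isArithPureGap_iff hm hsum hc hσ]
  refine and_congr_right fun _ => forall_congr' fun v => ?_
  rw [gapSum_mul_add hm, show -((m * k v + a v) * σ v) = -(a v * σ v) + m * (-(k v * σ v)) by ring,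
    gapSum_add_mul hm hsum hc]

/-- No entry of a pure gap is divisible by `m`. -/
theorem IsArithPureGap.not_dvd (hm : 0 < m) {a : Fin n → ℤ}
    (h : IsArithPureGap m r n lam c a) (v : Fin n) : ¬ (m : ℤ) ∣ a v := by
  intro hv
  obtain ⟨h0, h⟩ := (isArithPureGap_iff_forall_dvd hm a).1 h
  refine (h 0 le_rfl (by omega) v (by simpa using hv)).not_ge ?_
  simp only [gapSum, zero_mul, add_zero, fdivq_eq_ediv, Int.zero_ediv, sum_const_zero]
  exact sum_nonneg fun i _ => Int.ediv_nonneg (h0 i) (by omega)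

end gapSum

/-- The set of arithmetic pure gaps is completely determined by the bottom set
(the pure gaps with all entries in `{1,…,m-1}`). -/
theorem pureGaps_eq_from_bottom (m r : ℕ) (hm : 2 ≤ m) (hr : 1 ≤ r)
    (lam : Fin (r + 1) → ℤ) (hlam : ∀ i, lam i ≠ 0) (hsum : ∑ i, lam i = 0)
    (s : ℕ) (hsr : s ≤ r) (perm : Equiv.Perm (Fin (r + 1)))
    (c : Fin (s + 1) → Fin (r + 1))
    (hc : ∀ i, c i = perm (Fin.castLE (Nat.succ_le_succ hsr) i))
    (hgcd : ∀ i, Int.gcd (m : ℤ) (lam (c i)) = 1)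
    (σ : Fin (s + 1) → ℤ)
    (hσ : ∀ i, Int.ModEq (m : ℤ) (σ i * lam (c i)) 1) :
    {a : Fin (s + 1) → ℤ | IsArithPureGap m r (s + 1) lam c a} =
      {b : Fin (s + 1) → ℤ |
        ∃ a k₀ : Fin (s + 1) → ℤ,
          IsArithPureGap m r (s + 1) lam c a ∧
          (∀ i, 1 ≤ a i ∧ a i ≤ (m : ℤ) - 1) ∧
          (∀ i, 0 ≤ k₀ i) ∧
          (∑ i, k₀ i) ≤
            -1 - Finset.univ.sup' Finset.univ_nonempty (fun v : Fin (s + 1) =>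
              (∑ i : Fin (s + 1), fdivq m (a i - a v * σ v * lam (c i))) +
                ∑ w ∈ Finset.univ \ Finset.image c Finset.univ,
                  fdivq m (-(a v * σ v) * lam w)) ∧
          b = fun i => (m : ℤ) * k₀ i + a i} := by
  have hm0 : 0 < m := by omega
  have hm' : (0 : ℤ) < m := by exact_mod_cast hm0
  have hinj : Function.Injective c := fun i j h => by
    rw [hc, hc] at h
    exact Fin.castLE_injective _ (perm.injective h)
  have hgap : ∀ (a : Fin (s + 1) → ℤ) (v : Fin (s + 1)),
      (∑ i, fdivq m (a i - a v * σ v * lam (c i))) +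
        ∑ w ∈ univ \ image c univ, fdivq m (-(a v * σ v) * lam w) =
      gapSum m r (s + 1) lam c a (-(a v * σ v)) := fun a v => by
    simp only [gapSum, sub_eq_add_neg, neg_mul]
  have hsup : ∀ (f : Fin (s + 1) → ℤ) (K : ℤ),
      K ≤ -1 - univ.sup' univ_nonempty f ↔ ∀ v, f v + K < 0 := fun f K => by
    rw [le_sub_comm, sup'_le_iff]
    exact ⟨fun h v => by have := h v (mem_univ v); omega, fun h v _ => by have := h v; omega⟩
  ext b
  simp only [Set.mem_ofPred_eq, hgap, hsup]
  constructor
  · intro hb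
    have hdecomp : b = fun i => (m : ℤ) * (b i / m) + b i % m :=
      funext fun i => (Int.mul_ediv_add_emod (b i) m).symm
    have hk : ∀ i, 0 ≤ b i / m := fun i => Int.ediv_nonneg (hb.1 i) hm'.le
    have hneg := ((isArithPureGap_mul_add_iff hm0 hsum hinj hσ _ _).1 (hdecomp ▸ hb)).2
    refine ⟨fun i => b i % m, fun i => b i / m, ?_, fun i => ⟨?_, ?_⟩, hk, hneg, hdecomp⟩
    · rw [isArithPureGap_iff hm0 hsum hinj hσ]
      exact ⟨fun i => Int.emod_nonneg _ hm'.ne', fun v =>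
        (le_add_of_nonneg_right (sum_nonneg fun i _ => hk i)).trans_lt (hneg v)⟩
    · exact (Int.emod_nonneg _ hm'.ne').lt_of_ne'
        fun h => hb.not_dvd hm0 i (Int.dvd_of_emod_eq_zero h)
    · exact Int.le_sub_one_of_lt (Int.emod_lt_of_pos _ hm')
  · rintro ⟨a, k, ha, -, hk, hneg, rfl⟩
    exact (isArithPureGap_mul_add_iff hm0 hsum hinj hσ a k).2
      ⟨fun i => add_nonneg (mul_nonneg hm'.le (hk i)) (ha.1 i), hneg⟩
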